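/- There exists a constant C > 0 such that for every smooth w on ℝ₊×ℝ³, every dyadic τ ≥ 1, and every dyadic 1 ≤ R ≤ τ/2, ‖(∂_t+∂_r)² Z^{≤2} w‖_{L²L²(C̃^R_τ)} ≤ C ( R^{−1} ‖∂ Z^{≤3} w‖_{L²L²(C̃^R_τ)} + ‖(∂_t²−∂_r²) Z^{≤2} w‖_{L²L²(C̃^R_τ)} ). -/

import Mathlib

open MeasureTheory Set Filter
open scoped RealInnerProductSpace

noncomputable section

/-- Euclidean `ℝ³`. -/
abbrev E3 : Type := EuclideanSpace ℝ (Fin 3)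

/-- time derivative `∂_t u`. -/
def dt (u : ℝ → E3 → ℝ) (t : ℝ) (x : E3) : ℝ := deriv (fun s => u s x) t

/-- spatial gradient `∇_x u`. -/
def grad (u : ℝ → E3 → ℝ) (t : ℝ) (x : E3) : E3 := gradient (u t) x

/-- radial derivative `∂_r u = (x/r)·∇_x u`. -/
def dr (u : ℝ → E3 → ℝ) (t : ℝ) (x : E3) : ℝ := ⟪(‖x‖⁻¹) • x, gradient (u t) x⟫

/-- angular gradient `∇̸u = ∇_x u − (x/r) ∂_r u`. -/
def angGrad (u : ℝ → E3 → ℝ) (t : ℝ) (x : E3) : E3 :=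
  gradient (u t) x - (‖x‖⁻¹ * dr u t x) • x

/-- coordinate partial derivative on `ℝ³`. -/
def pd (i : Fin 3) (f : E3 → ℝ) (x : E3) : ℝ := fderiv ℝ f x (EuclideanSpace.single i 1)

/-- spatial Laplacian. -/
def lap (f : E3 → ℝ) (x : E3) : ℝ := ∑ i : Fin 3, pd i (fun y => pd i f y) x

/-- d'Alembertian `□u = ∂_t²u − Δ_x u`. -/
def box (u : ℝ → E3 → ℝ) (t : ℝ) (x : E3) : ℝ := deriv (fun s => dt u s x) t - lap (u t) x

/-- `|∂u|²`, the squared length of the space-time gradient. -/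
def DuSq (u : ℝ → E3 → ℝ) (t : ℝ) (x : E3) : ℝ := (dt u t x)^2 + ‖grad u t x‖^2

/-- `L²L²` norm over a space-time region `Q`. -/
def L2st (f : ℝ → E3 → ℝ) (Q : Set (ℝ × E3)) : ℝ :=
  Real.sqrt (∫ q in Q, (f q.1 q.2)^2)

/-- `L²` norm in space. -/
def L2x (g : E3 → ℝ) : ℝ := Real.sqrt (∫ x : E3, (g x)^2)

/-- `L∞L²` norm over `ℝ₊×ℝ³`. -/
def LinfL2 (f : ℝ → E3 → ℝ) : ℝ := ⨆ t : Ici (0:ℝ), L2x (f t.1)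

/-- `L²L²` norm over `ℝ₊×ℝ³`. -/
def L2L2 (f : ℝ → E3 → ℝ) : ℝ := L2st f (Ici 0 ×ˢ univ)

/-- the dyadic strip `C_τ = {τ ≤ t ≤ 2τ, r ≤ t+2}`. -/
def Cstrip (τ : ℝ) : Set (ℝ × E3) := {q | τ ≤ q.1 ∧ q.1 ≤ 2*τ ∧ ‖q.2‖ ≤ q.1 + 2}

/-- the region `C^R_τ` (with the conventions for `R = 1` and `R = τ/2`). -/
def CRreg (τ R : ℝ) : Set (ℝ × E3) :=
  if R = 1 then Cstrip τ ∩ {q | ‖q.2‖ ≤ 2}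
  else if R = τ/2 then Cstrip τ ∩ {q | τ/2 ≤ q.1 - ‖q.2‖ ∧ τ/2 ≤ ‖q.2‖}
  else Cstrip τ ∩ {q | R ≤ ‖q.2‖ ∧ ‖q.2‖ ≤ 2*R}

/-- the region `C^U_τ` (with the convention for `U = 1`). -/
def CUreg (τ U : ℝ) : Set (ℝ × E3) :=
  if U = 1 then Cstrip τ ∩ {q | |q.1 - ‖q.2‖| ≤ 2}
  else Cstrip τ ∩ {q | U ≤ q.1 - ‖q.2‖ ∧ q.1 - ‖q.2‖ ≤ 2*U}

/-- the enlarged region `C̃^R_τ`. -/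
def CRtilde (τ R : ℝ) : Set (ℝ × E3) :=
  {q | 7/8*τ ≤ q.1 ∧ q.1 ≤ 17/8*τ ∧ ‖q.2‖ ≤ q.1 + 2} ∩
  (if R = 1 then {q | ‖q.2‖ ≤ 17/8} else {q | 7/8*R ≤ ‖q.2‖ ∧ ‖q.2‖ ≤ 17/8*R})

/-- the enlarged region `C̃^U_τ`. -/
def CUtilde (τ U : ℝ) : Set (ℝ × E3) :=
  {q | 7/8*τ ≤ q.1 ∧ q.1 ≤ 17/8*τ ∧ ‖q.2‖ ≤ q.1 + 2} ∩
  (if U = 1 then {q | |q.1 - ‖q.2‖| ≤ 17/8}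
   else {q | 7/8*U ≤ q.1 - ‖q.2‖ ∧ q.1 - ‖q.2‖ ≤ 17/8*U})

/-- `X_U = {U ≤ 1+|t−r| ≤ 2U}`. -/
def XUreg (U : ℝ) : Set (ℝ × E3) :=
  {q | U ≤ 1 + |q.1 - ‖q.2‖| ∧ 1 + |q.1 - ‖q.2‖| ≤ 2*U}

/-- the admissible vector fields `∂_t, ∂_{x_i}, Ω_{ij}, S` on `ℝ₊×ℝ³`. -/
def Zop : Fin 8 → (ℝ → E3 → ℝ) → (ℝ → E3 → ℝ) :=
  ![fun u t x => dt u t x,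
    fun u t x => pd 0 (u t) x,
    fun u t x => pd 1 (u t) x,
    fun u t x => pd 2 (u t) x,
    fun u t x => x 0 * pd 1 (u t) x - x 1 * pd 0 (u t) x,
    fun u t x => x 0 * pd 2 (u t) x - x 2 * pd 0 (u t) x,
    fun u t x => x 1 * pd 2 (u t) x - x 2 * pd 1 (u t) x,
    fun u t x => t * dt u t x + ⟪x, gradient (u t) x⟫]

/-- composition `Z^μ` of admissible vector fields. -/
def Ziter : List (Fin 8) → (ℝ → E3 → ℝ) → (ℝ → E3 → ℝ)
  | [] => fun u => u
  | i :: l => fun u => Zop i (Ziter l u)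

/-- `‖T Z^{≤N} w‖_{L²L²(Q)}`: the sum over all compositions `Z^μ` of at most `N`
admissible fields of the `L²L²(Q)` norms of `T (Z^μ w)`. -/
def ZnormT (T : (ℝ → E3 → ℝ) → (ℝ → E3 → ℝ)) (N : ℕ) (w : ℝ → E3 → ℝ)
    (Q : Set (ℝ × E3)) : ℝ :=
  ∑ n ∈ Finset.range (N+1), ∑ σ : Fin n → Fin 8, L2st (T (Ziter (List.ofFn σ) w)) Q

/-- `‖Z^{≤N} w‖_{L²L²(Q)}`. -/
def Znorm (N : ℕ) (w : ℝ → E3 → ℝ) (Q : Set (ℝ × E3)) : ℝ := ZnormT (fun v => v) N w Q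

/-- `‖∂_r Z^{≤N} w‖_{L²L²(Q)}`. -/
def ZnormDr (N : ℕ) (w : ℝ → E3 → ℝ) (Q : Set (ℝ × E3)) : ℝ :=
  ZnormT (fun v => fun t x => dr v t x) N w Q

/-- `‖∂ Z^{≤N} w‖_{L²L²(Q)}`. -/
def ZnormD (N : ℕ) (w : ℝ → E3 → ℝ) (Q : Set (ℝ × E3)) : ℝ :=
  ZnormT (fun v => fun t x => Real.sqrt (DuSq v t x)) N w Q

/-- `‖□ Z^{≤N} w‖_{L²L²(Q)}`. -/
def ZnormBox (N : ℕ) (w : ℝ → E3 → ℝ) (Q : Set (ℝ × E3)) : ℝ :=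
  ZnormT (fun v => fun t x => box v t x) N w Q

/-- `(∂_t + ∂_r) v`. -/
def Dop (v : ℝ → E3 → ℝ) : ℝ → E3 → ℝ := fun t x => dt v t x + dr v t x

/-- `∂_t² v`. -/
def dtdt (v : ℝ → E3 → ℝ) (t : ℝ) (x : E3) : ℝ := deriv (fun s => dt v s x) t

/-- `(∂_t² − ∂_r²) v`. -/
def wave2 (v : ℝ → E3 → ℝ) : ℝ → E3 → ℝ := fun t x => dtdt v t x - dr (dr v) t x

/-- `‖(∂_t + ∂_r)² Z^{≤2} w‖_{L²L²(Q)}`. -/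
def ZnormDD (w : ℝ → E3 → ℝ) (Q : Set (ℝ × E3)) : ℝ := ZnormT (fun v => Dop (Dop v)) 2 w Q

/-- `‖(∂_t²−∂_r²) Z^{≤2} w‖_{L²L²(Q)}`. -/
def ZnormW (w : ℝ → E3 → ℝ) (Q : Set (ℝ × E3)) : ℝ := ZnormT wave2 2 w Q

/-- Smoothness of `u` on the open half-space `t > 0`. -/
def SmoothPos (u : ℝ → E3 → ℝ) : Prop :=
  ContDiffOn ℝ (⊤ : ℕ∞) (fun q : ℝ × E3 => u q.1 q.2) (Ioi 0 ×ˢ univ)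

lemma isOpen_posHalfSpace : IsOpen (Ioi (0:ℝ) ×ˢ (univ : Set E3)) := isOpen_Ioi.prod isOpen_univ

/-- The space-time differential of `u`. -/
def stDeriv (u : ℝ → E3 → ℝ) (q : ℝ × E3) : ℝ × E3 →L[ℝ] ℝ :=
  fderiv ℝ (fun q : ℝ × E3 => u q.1 q.2) q

/-- The space-time Hessian of `u`. -/
def stHess (u : ℝ → E3 → ℝ) (q : ℝ × E3) : ℝ × E3 →L[ℝ] ℝ × E3 →L[ℝ] ℝ :=
  fderiv ℝ (stDeriv u) q

namespace SmoothPos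

variable {u : ℝ → E3 → ℝ}

lemma contDiffAt (hu : SmoothPos u) {q : ℝ × E3} (hq : 0 < q.1) :
    ContDiffAt ℝ (⊤ : ℕ∞) (fun q : ℝ × E3 => u q.1 q.2) q :=
  ContDiffOn.contDiffAt hu (isOpen_posHalfSpace.mem_nhds ⟨hq, mem_univ _⟩)

lemma contDiffOn_stDeriv (hu : SmoothPos u) :
    ContDiffOn ℝ (⊤ : ℕ∞) (stDeriv u) (Ioi 0 ×ˢ univ) :=
  ContDiffOn.fderiv_of_isOpen hu isOpen_posHalfSpace (by simp)

lemma contDiffOn_stHess (hu : SmoothPos u) :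
    ContDiffOn ℝ (⊤ : ℕ∞) (stHess u) (Ioi 0 ×ˢ univ) :=
  hu.contDiffOn_stDeriv.fderiv_of_isOpen isOpen_posHalfSpace (by simp)

lemma hasFDerivAt (hu : SmoothPos u) {q : ℝ × E3} (hq : 0 < q.1) :
    HasFDerivAt (fun q : ℝ × E3 => u q.1 q.2) (stDeriv u q) q :=
  ((hu.contDiffAt hq).differentiableAt (by simp)).hasFDerivAt

lemma hasFDerivAt_stDeriv (hu : SmoothPos u) {q : ℝ × E3} (hq : 0 < q.1) :
    HasFDerivAt (stDeriv u) (stHess u q) q :=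
  ((hu.contDiffOn_stDeriv.contDiffAt
    (isOpen_posHalfSpace.mem_nhds ⟨hq, mem_univ _⟩)).differentiableAt (by simp)).hasFDerivAt

lemma stHess_comm (hu : SmoothPos u) {q : ℝ × E3} (hq : 0 < q.1) (a b : ℝ × E3) :
    stHess u q a b = stHess u q b a :=
  (hu.contDiffAt hq).isSymmSndFDerivAt
    (by simpa using WithTop.coe_le_coe.2 (le_top : (2 : ℕ∞) ≤ ⊤)) a b

end SmoothPos

/-- If `u` is differentiable in space-time, its time derivative is the differential in `(1,0)`. -/
lemma dt_eq_of_hasFDerivAt {u : ℝ → E3 → ℝ} {L : ℝ × E3 →L[ℝ] ℝ} {q : ℝ × E3}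
    (h : HasFDerivAt (fun q : ℝ × E3 => u q.1 q.2) L q) : dt u q.1 q.2 = L (1, 0) := by
  have h1 : HasDerivAt (fun s : ℝ => ((s, q.2) : ℝ × E3)) (1, 0) q.1 :=
    (hasDerivAt_id q.1).prodMk (hasDerivAt_const q.1 q.2)
  exact (HasFDerivAt.comp_hasDerivAt (f := fun s : ℝ => ((s, q.2) : ℝ × E3)) q.1 h h1).deriv

lemma fderiv_eq_of_hasFDerivAt {u : ℝ → E3 → ℝ} {L : ℝ × E3 →L[ℝ] ℝ} {q : ℝ × E3}
    (h : HasFDerivAt (fun q : ℝ × E3 => u q.1 q.2) L q) :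
    fderiv ℝ (u q.1) q.2 = L.comp (ContinuousLinearMap.inr ℝ ℝ E3) := by
  have h1 : HasFDerivAt (fun y : E3 => ((q.1, y) : ℝ × E3))
      (ContinuousLinearMap.inr ℝ ℝ E3) q.2 := hasFDerivAt_prodMk_right q.1 q.2
  exact (HasFDerivAt.comp (f := fun y : E3 => ((q.1, y) : ℝ × E3)) q.2 h h1).fderiv

lemma inner_gradient_eq_of_hasFDerivAt {u : ℝ → E3 → ℝ} {L : ℝ × E3 →L[ℝ] ℝ} {q : ℝ × E3}
    (h : HasFDerivAt (fun q : ℝ × E3 => u q.1 q.2) L q) (y : E3) :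
    ⟪y, gradient (u q.1) q.2⟫ = L (0, y) := by
  rw [real_inner_comm, gradient, InnerProductSpace.toDual_symm_apply,
    fderiv_eq_of_hasFDerivAt h]
  simp

lemma norm_grad_eq_of_hasFDerivAt {u : ℝ → E3 → ℝ} {L : ℝ × E3 →L[ℝ] ℝ} {q : ℝ × E3}
    (h : HasFDerivAt (fun q : ℝ × E3 => u q.1 q.2) L q) :
    ‖grad u q.1 q.2‖ = ‖L.comp (ContinuousLinearMap.inr ℝ ℝ E3)‖ := by
  rw [grad, gradient, LinearIsometryEquiv.norm_map, fderiv_eq_of_hasFDerivAt h]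

/-- The space-time field `∂_r`. -/
def radialDir (q : ℝ × E3) : ℝ × E3 := (0, ‖q.2‖⁻¹ • q.2)

lemma norm_radialDir_le (q : ℝ × E3) : ‖radialDir q‖ ≤ 1 := by
  rcases eq_or_ne q.2 0 with h | h
  · simp [radialDir, h]
  · simp [radialDir, norm_smul, Prod.norm_def, h]

lemma dr_eq_of_hasFDerivAt {u : ℝ → E3 → ℝ} {L : ℝ × E3 →L[ℝ] ℝ} {q : ℝ × E3}
    (h : HasFDerivAt (fun q : ℝ × E3 => u q.1 q.2) L q) :
    dr u q.1 q.2 = L (radialDir q) :=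
  inner_gradient_eq_of_hasFDerivAt h _

/-- The field `∂_r` is smooth away from `r = 0`, and it is constant along itself and in time. -/
lemma exists_hasFDerivAt_radialDir {q : ℝ × E3} (hq : q.2 ≠ 0) :
    ∃ A : ℝ × E3 →L[ℝ] ℝ × E3, HasFDerivAt radialDir A q ∧ A (1, 0) = 0 ∧
      A (radialDir q) = 0 := by
  have hd : DifferentiableAt ℝ radialDir q := by
    have h1 : DifferentiableAt ℝ (fun q : ℝ × E3 => ‖q.2‖) q :=
      differentiableAt_snd.norm ℝ hq
    exact (differentiableAt_const (0:ℝ)).prodMk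
      ((h1.inv (norm_ne_zero_iff.2 hq)).smul differentiableAt_snd)
  refine ⟨fderiv ℝ radialDir q, hd.hasFDerivAt, ?_, ?_⟩
  · have h1 : HasDerivAt (fun s : ℝ => ((s, q.2) : ℝ × E3)) (1, 0) q.1 :=
      (hasDerivAt_id q.1).prodMk (hasDerivAt_const q.1 q.2)
    have h2 := HasFDerivAt.comp_hasDerivAt (f := fun s : ℝ => ((s, q.2) : ℝ × E3)) q.1
      hd.hasFDerivAt h1
    exact h2.unique (hasDerivAt_const q.1 (radialDir q))
  · have h1 : HasDerivAt (fun s : ℝ => q + s • radialDir q) (radialDir q) 0 := by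
      simpa using ((hasDerivAt_id (0:ℝ)).smul_const (radialDir q)).const_add q
    have h2 := HasFDerivAt.comp_hasDerivAt_of_eq (f := fun s : ℝ => q + s • radialDir q) 0
      hd.hasFDerivAt h1 (by simp)
    refine h2.unique ((hasDerivAt_const 0 (radialDir q)).congr_of_eventuallyEq ?_)
    have hn : 0 < ‖q.2‖ := norm_pos_iff.2 hq
    filter_upwards [Ioi_mem_nhds (show -‖q.2‖ < (0:ℝ) by linarith)] with s hs
    have hc : 0 < 1 + s * ‖q.2‖⁻¹ := by
      have : -‖q.2‖ * ‖q.2‖⁻¹ < s * ‖q.2‖⁻¹ := by gcongr; exact hs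
      rw [neg_mul, mul_inv_cancel₀ hn.ne'] at this
      linarith
    have e : (q + s • radialDir q).2 = (1 + s * ‖q.2‖⁻¹) • q.2 := by
      simp [radialDir, add_smul, smul_smul]
    change ((0:ℝ), ‖(q + s • radialDir q).2‖⁻¹ • (q + s • radialDir q).2) = (0, ‖q.2‖⁻¹ • q.2)
    rw [e, norm_smul, Real.norm_of_nonneg hc.le, smul_smul, mul_inv,
      mul_right_comm, inv_mul_cancel₀ hc.ne', one_mul]

/-- Derivative of `q ↦ Du(q)[e(q)]` in the direction `a`. -/
lemma SmoothPos.hasFDerivAt_stDeriv_apply {u : ℝ → E3 → ℝ} (hu : SmoothPos u)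
    {g : ℝ → E3 → ℝ} {e : ℝ × E3 → ℝ × E3} {A : ℝ × E3 →L[ℝ] ℝ × E3} {q : ℝ × E3} (hq : 0 < q.1)
    (he : HasFDerivAt e A q)
    (hg : ∀ᶠ p in nhds q, g p.1 p.2 = stDeriv u p (e p)) :
    ∃ L : ℝ × E3 →L[ℝ] ℝ, HasFDerivAt (fun p : ℝ × E3 => g p.1 p.2) L q ∧
      ∀ a, L a = stHess u q a (e q) + stDeriv u q (A a) := by
  refine ⟨_, ((hu.hasFDerivAt_stDeriv hq).clm_apply he).congr_of_eventuallyEq hg, fun a => ?_⟩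
  simp [add_comm]

lemma eventually_pos_time {q : ℝ × E3} (hq : 0 < q.1) : ∀ᶠ p : ℝ × E3 in nhds q, 0 < p.1 :=
  continuous_fst.continuousAt.eventually (lt_mem_nhds hq)

lemma SmoothPos.dtdt_eq {u : ℝ → E3 → ℝ} (hu : SmoothPos u) {q : ℝ × E3} (hq : 0 < q.1) :
    dtdt u q.1 q.2 = stHess u q (1, 0) (1, 0) := by
  obtain ⟨L, hL, hLa⟩ := hu.hasFDerivAt_stDeriv_apply (g := dt u) hq
    (hasFDerivAt_const ((1:ℝ), (0:E3)) q)
    ((eventually_pos_time hq).mono fun p hp => dt_eq_of_hasFDerivAt (hu.hasFDerivAt hp))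
  have h : dtdt u q.1 q.2 = L (1, 0) := dt_eq_of_hasFDerivAt hL
  rw [h, hLa]; simp

lemma SmoothPos.dr_dr_eq {u : ℝ → E3 → ℝ} (hu : SmoothPos u) {q : ℝ × E3} (hq : 0 < q.1)
    (hx : q.2 ≠ 0) :
    dr (dr u) q.1 q.2 = stHess u q (radialDir q) (radialDir q) := by
  obtain ⟨A, hA, -, hAr⟩ := exists_hasFDerivAt_radialDir hx
  obtain ⟨L, hL, hLa⟩ := hu.hasFDerivAt_stDeriv_apply (g := dr u) hq hA
    ((eventually_pos_time hq).mono fun p hp => dr_eq_of_hasFDerivAt (hu.hasFDerivAt hp))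
  rw [dr_eq_of_hasFDerivAt hL, hLa, hAr]; simp

lemma SmoothPos.wave2_eq {u : ℝ → E3 → ℝ} (hu : SmoothPos u) {q : ℝ × E3} (hq : 0 < q.1)
    (hx : q.2 ≠ 0) :
    wave2 u q.1 q.2 =
      stHess u q (1, 0) (1, 0) - stHess u q (radialDir q) (radialDir q) := by
  rw [wave2, hu.dtdt_eq hq, hu.dr_dr_eq hq hx]

lemma SmoothPos.Dop_Dop_eq {u : ℝ → E3 → ℝ} (hu : SmoothPos u) {q : ℝ × E3} (hq : 0 < q.1)
    (hx : q.2 ≠ 0) :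
    Dop (Dop u) q.1 q.2 = stHess u q (1, 0) (1, 0) + 2 * stHess u q (1, 0) (radialDir q) +
      stHess u q (radialDir q) (radialDir q) := by
  obtain ⟨A, hA, hAt, hAr⟩ := exists_hasFDerivAt_radialDir hx
  obtain ⟨L, hL, hLa⟩ := hu.hasFDerivAt_stDeriv_apply (g := Dop u) hq
    ((hasFDerivAt_const ((1:ℝ), (0:E3)) q).add hA)
    ((eventually_pos_time hq).mono fun p hp => by
      have h := hu.hasFDerivAt hp
      simp [Dop, dt_eq_of_hasFDerivAt h, dr_eq_of_hasFDerivAt h])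
  have hs := hu.stHess_comm hq (radialDir q) (1, 0)
  rw [Dop, dt_eq_of_hasFDerivAt hL, dr_eq_of_hasFDerivAt hL, hLa, hLa]
  simp [hAt, hAr, hs]
  ring

lemma time_smul_add_radialDir (q : ℝ × E3) :
    q.1 • ((1:ℝ), (0:E3)) + ‖q.2‖ • radialDir q = q := by
  rcases eq_or_ne q.2 0 with h | h
  · ext1 <;> simp [radialDir, h]
  · ext1 <;> simp [radialDir, smul_smul, h]

lemma SmoothPos.scaling_eq {u : ℝ → E3 → ℝ} (hu : SmoothPos u) {q : ℝ × E3} (hq : 0 < q.1) :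
    Zop 7 u q.1 q.2 = stDeriv u q q := by
  have h := hu.hasFDerivAt hq
  change q.1 * dt u q.1 q.2 + ⟪q.2, gradient (u q.1) q.2⟫ = _
  rw [dt_eq_of_hasFDerivAt h, inner_gradient_eq_of_hasFDerivAt h, ← smul_eq_mul, ← map_smul,
    ← map_add]
  simp

lemma SmoothPos.Dop_scaling_eq {u : ℝ → E3 → ℝ} (hu : SmoothPos u) {q : ℝ × E3}
    (hq : 0 < q.1) :
    Dop (Zop 7 u) q.1 q.2 = q.1 * stHess u q (1, 0) (1, 0) +
      (q.1 + ‖q.2‖) * stHess u q (1, 0) (radialDir q) +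
      ‖q.2‖ * stHess u q (radialDir q) (radialDir q) + Dop u q.1 q.2 := by
  obtain ⟨L, hL, hLa⟩ := hu.hasFDerivAt_stDeriv_apply (g := Zop 7 u) hq (hasFDerivAt_id q)
    ((eventually_pos_time hq).mono fun p hp => hu.scaling_eq hp)
  have h := hu.hasFDerivAt hq
  have hH : ∀ a, stHess u q a q =
      q.1 * stHess u q a (1, 0) + ‖q.2‖ * stHess u q a (radialDir q) := fun a => by
    have e := congrArg (stHess u q a) (time_smul_add_radialDir q)
    rw [map_add, map_smul, map_smul, smul_eq_mul, smul_eq_mul] at e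
    exact e.symm
  have hs := hu.stHess_comm hq (radialDir q) (1, 0)
  rw [Dop, Dop, dt_eq_of_hasFDerivAt hL, dr_eq_of_hasFDerivAt hL, dt_eq_of_hasFDerivAt h,
    dr_eq_of_hasFDerivAt h, hLa, hLa]
  simp only [id_eq, ContinuousLinearMap.id_apply, hH, hs]
  ring

/-- `|(∂_t + ∂_r) u|` is controlled by the space-time gradient. -/
lemma abs_Dop_le (u : ℝ → E3 → ℝ) (t : ℝ) (x : E3) :
    |Dop u t x| ≤ 2 * √(DuSq u t x) := by
  have h1 : |dt u t x| ≤ √(DuSq u t x) := by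
    apply Real.abs_le_sqrt
    rw [DuSq]; nlinarith [sq_nonneg ‖grad u t x‖]
  have h2 : |dr u t x| ≤ √(DuSq u t x) := by
    have h3 : |dr u t x| ≤ ‖grad u t x‖ := by
      refine (abs_real_inner_le_norm _ _).trans ?_
      refine mul_le_of_le_one_left (norm_nonneg _) ?_
      rw [norm_smul, norm_inv, norm_norm]
      exact inv_mul_le_one
    refine h3.trans (Real.le_sqrt_of_sq_le ?_)
    rw [DuSq]; nlinarith [sq_nonneg (dt u t x)]
  rw [Dop]
  linarith [abs_add_le (dt u t x) (dr u t x)]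

/-- Pointwise bound of `(∂_t + ∂_r)² u` through the identity
`(t + r)(∂_t + ∂_r)² u = 2((∂_t + ∂_r)S u - (∂_t + ∂_r)u) - (t - r)(∂_t² - ∂_r²)u`. -/
lemma SmoothPos.abs_Dop_Dop_le {u : ℝ → E3 → ℝ} (hu : SmoothPos u) {q : ℝ × E3} {R : ℝ}
    (hR : 0 < R) (hq : R ≤ q.1) (hx : q.2 ≠ 0) :
    |Dop (Dop u) q.1 q.2| ≤ 4 * R⁻¹ * √(DuSq (Zop 7 u) q.1 q.2) +
      4 * R⁻¹ * √(DuSq u q.1 q.2) + |wave2 u q.1 q.2| := by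
  have hq0 : 0 < q.1 := hR.trans_le hq
  have hr : 0 ≤ ‖q.2‖ := norm_nonneg _
  have hid : (q.1 + ‖q.2‖) * Dop (Dop u) q.1 q.2 =
      2 * (Dop (Zop 7 u) q.1 q.2 - Dop u q.1 q.2) - (q.1 - ‖q.2‖) * wave2 u q.1 q.2 := by
    rw [hu.Dop_Dop_eq hq0 hx, hu.Dop_scaling_eq hq0, hu.wave2_eq hq0 hx]; ring
  have hS := abs_Dop_le (Zop 7 u) q.1 q.2
  have hU := abs_Dop_le u q.1 q.2
  set a := √(DuSq (Zop 7 u) q.1 q.2)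
  set b := √(DuSq u q.1 q.2)
  have ha : 0 ≤ a := Real.sqrt_nonneg _
  have hb : 0 ≤ b := Real.sqrt_nonneg _
  have hs : 0 < q.1 + ‖q.2‖ := by linarith
  have h1 : (q.1 + ‖q.2‖) * |Dop (Dop u) q.1 q.2| ≤
      4 * (a + b) + (q.1 + ‖q.2‖) * |wave2 u q.1 q.2| := by
    rw [← abs_of_pos hs, ← abs_mul, hid, abs_of_pos hs]
    have h2 := abs_sub (2 * (Dop (Zop 7 u) q.1 q.2 - Dop u q.1 q.2))
      ((q.1 - ‖q.2‖) * wave2 u q.1 q.2)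
    have h3 := abs_sub (Dop (Zop 7 u) q.1 q.2) (Dop u q.1 q.2)
    rw [abs_mul, abs_mul, abs_two] at h2
    have h4 : |q.1 - ‖q.2‖| ≤ q.1 + ‖q.2‖ := abs_le.2 ⟨by linarith, by linarith⟩
    have h5 := mul_le_mul_of_nonneg_right h4 (abs_nonneg (wave2 u q.1 q.2))
    linarith
  refine le_of_mul_le_mul_left (h1.trans ?_) hs
  have h6 : 1 ≤ (q.1 + ‖q.2‖) * R⁻¹ := by
    rw [← div_eq_mul_inv, one_le_div hR]; linarith
  nlinarith [mul_le_mul_of_nonneg_right h6 (add_nonneg ha hb)]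

lemma SmoothPos.zop {u : ℝ → E3 → ℝ} (hu : SmoothPos u) (i : Fin 8) : SmoothPos (Zop i u) := by
  have hD := hu.contDiffOn_stDeriv
  have hdt : ContDiffOn ℝ (⊤ : ℕ∞) (fun q : ℝ × E3 => dt u q.1 q.2) (Ioi 0 ×ˢ univ) :=
    (hD.clm_apply contDiffOn_const).congr
      fun q hq => dt_eq_of_hasFDerivAt (hu.hasFDerivAt hq.1)
  have hpd (i : Fin 3) :
      ContDiffOn ℝ (⊤ : ℕ∞) (fun q : ℝ × E3 => pd i (u q.1) q.2) (Ioi 0 ×ˢ univ) :=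
    (hD.clm_apply (contDiffOn_const (c := ((0:ℝ), EuclideanSpace.single i (1:ℝ))))).congr
      fun q hq => by
        rw [pd, fderiv_eq_of_hasFDerivAt (hu.hasFDerivAt hq.1)]; simp
  have hx (i : Fin 3) :
      ContDiffOn ℝ (⊤ : ℕ∞) (fun q : ℝ × E3 => q.2 i) (Ioi 0 ×ˢ univ) := by fun_prop
  fin_cases i
  · exact hdt
  · exact hpd 0
  · exact hpd 1
  · exact hpd 2
  · exact ((hx 0).mul (hpd 1)).sub ((hx 1).mul (hpd 0))
  · exact ((hx 0).mul (hpd 2)).sub ((hx 2).mul (hpd 0))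
  · exact ((hx 1).mul (hpd 2)).sub ((hx 2).mul (hpd 1))
  · exact (hD.clm_apply contDiffOn_id).congr fun q hq => hu.scaling_eq hq.1

lemma SmoothPos.ziter {u : ℝ → E3 → ℝ} (hu : SmoothPos u) :
    ∀ l : List (Fin 8), SmoothPos (Ziter l u)
  | [] => hu
  | i :: l => (hu.ziter l).zop i

lemma SmoothPos.integrableOn_DuSq {u : ℝ → E3 → ℝ} (hu : SmoothPos u) {K : Set (ℝ × E3)}
    (hK : IsCompact K) (hpos : ∀ q ∈ K, 0 < q.1) :
    IntegrableOn (fun q : ℝ × E3 => DuSq u q.1 q.2) K := by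
  have hD : ContinuousOn (stDeriv u) K :=
    hu.contDiffOn_stDeriv.continuousOn.mono fun q hq => ⟨hpos q hq, mem_univ _⟩
  have hc : ContinuousOn (fun q => (stDeriv u q (1, 0)) ^ 2 +
      ‖(stDeriv u q).comp (ContinuousLinearMap.inr ℝ ℝ E3)‖ ^ 2) K :=
    ((hD.clm_apply continuousOn_const).pow 2).add ((hD.clm_comp continuousOn_const).norm.pow 2)
  refine (hc.congr fun q hq => ?_).integrableOn_compact hK
  have h := hu.hasFDerivAt (hpos q hq)
  rw [DuSq, dt_eq_of_hasFDerivAt h, norm_grad_eq_of_hasFDerivAt h]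

lemma ae_space_ne_zero : ∀ᵐ q : ℝ × E3, q.2 ≠ 0 := by
  rw [ae_iff]
  have h : {q : ℝ × E3 | ¬ q.2 ≠ 0} = univ ×ˢ {0} := by ext; simp
  rw [h, Measure.volume_eq_prod, Measure.prod_prod]
  simp

lemma measurable_radialDir : Measurable radialDir := by
  unfold radialDir; fun_prop

lemma abs_apply_apply_le {F : Type*} [NormedAddCommGroup F] [NormedSpace ℝ F]
    (B : F →L[ℝ] F →L[ℝ] ℝ) {e : F} (he : ‖e‖ ≤ 1) : |B e e| ≤ ‖B‖ := by
  refine (B.le_opNorm₂ e e).trans ?_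
  rw [mul_assoc]
  exact mul_le_of_le_one_right B.opNorm_nonneg (mul_le_one₀ he (norm_nonneg _) he)

lemma SmoothPos.integrableOn_wave2_sq {u : ℝ → E3 → ℝ} (hu : SmoothPos u) {K : Set (ℝ × E3)}
    (hK : IsCompact K) (hpos : ∀ q ∈ K, 0 < q.1) :
    IntegrableOn (fun q : ℝ × E3 => (wave2 u q.1 q.2) ^ 2) K := by
  have hH : ContinuousOn (stHess u) K :=
    hu.contDiffOn_stHess.continuousOn.mono fun q hq => ⟨hpos q hq, mem_univ _⟩
  have hHm : AEStronglyMeasurable (stHess u) (volume.restrict K) :=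
    hH.aestronglyMeasurable hK.measurableSet
  have hrm : AEStronglyMeasurable radialDir (volume.restrict K) :=
    measurable_radialDir.aestronglyMeasurable
  obtain ⟨M, hM⟩ := hK.exists_bound_of_continuousOn (f := stHess u) hH
  set W : ℝ × E3 → ℝ := fun q =>
    stHess u q (1, 0) (1, 0) - stHess u q (radialDir q) (radialDir q) with hW
  have hWm : AEStronglyMeasurable W (volume.restrict K) := by
    have hc : Continuous (fun p : (ℝ × E3 →L[ℝ] ℝ × E3 →L[ℝ] ℝ) × (ℝ × E3) =>
        p.1 (1, 0) (1, 0) - p.1 p.2 p.2) := by fun_prop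
    exact hc.comp_aestronglyMeasurable (hHm.prodMk hrm)
  have hb (q) (hq : q ∈ K) (e : ℝ × E3) (he : ‖e‖ ≤ 1) : |stHess u q e e| ≤ M := by
    exact (abs_apply_apply_le (stHess u q) he).trans (hM q hq)
  have hint : IntegrableOn (fun q => (W q) ^ 2) K := by
    have : IsFiniteMeasure (volume.restrict K) := ⟨by simpa using hK.measure_lt_top⟩
    refine Integrable.of_bound (hWm.pow 2) ((2 * M) ^ 2) ?_
    refine (ae_restrict_iff' hK.measurableSet).2 (Eventually.of_forall fun q hq => ?_)
    rw [Real.norm_eq_abs, abs_pow]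
    refine pow_le_pow_left₀ (abs_nonneg _) ?_ 2
    have h1 := hb q hq (1, 0) (by simp [Prod.norm_def])
    have h2 := hb q hq _ (norm_radialDir_le q)
    have h3 := abs_sub (stHess u q (1, 0) (1, 0)) (stHess u q (radialDir q) (radialDir q))
    simp only [hW]
    linarith
  refine hint.congr ((ae_restrict_iff' hK.measurableSet).2 ?_)
  filter_upwards [ae_space_ne_zero] with q hx hq
  simp only [hW]
  rw [hu.wave2_eq (hpos q hq) hx]

lemma L2st_nonneg (f : ℝ → E3 → ℝ) (Q : Set (ℝ × E3)) : 0 ≤ L2st f Q := Real.sqrt_nonneg _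

/-- Minkowski-type inequality for a pointwise a.e. bound by three terms. -/
lemma L2st_le_of_ae_abs_le {f g₁ g₂ g₃ : ℝ → E3 → ℝ} {Q : Set (ℝ × E3)} {c : ℝ} (hc : 0 ≤ c)
    (h₁ : IntegrableOn (fun q : ℝ × E3 => (g₁ q.1 q.2) ^ 2) Q)
    (h₂ : IntegrableOn (fun q : ℝ × E3 => (g₂ q.1 q.2) ^ 2) Q)
    (h₃ : IntegrableOn (fun q : ℝ × E3 => (g₃ q.1 q.2) ^ 2) Q)
    (h : ∀ᵐ q : ℝ × E3 ∂(volume.restrict Q),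
      |f q.1 q.2| ≤ c * g₁ q.1 q.2 + c * g₂ q.1 q.2 + |g₃ q.1 q.2|) :
    L2st f Q ≤ 2 * (c * (L2st g₁ Q + L2st g₂ Q) + L2st g₃ Q) := by
  have hle : ∫ q in Q, (f q.1 q.2) ^ 2 ≤
      ∫ q in Q, (3 * c ^ 2 * (g₁ q.1 q.2) ^ 2 + 3 * c ^ 2 * (g₂ q.1 q.2) ^ 2 +
        3 * (g₃ q.1 q.2) ^ 2) := by
    refine integral_mono_of_nonneg (Eventually.of_forall fun q => sq_nonneg _)
      (((h₁.const_mul _).add (h₂.const_mul _)).add (h₃.const_mul _)) ?_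
    filter_upwards [h] with q hq
    have h0 : (f q.1 q.2) ^ 2 ≤ (c * g₁ q.1 q.2 + c * g₂ q.1 q.2 + |g₃ q.1 q.2|) ^ 2 :=
      sq_le_sq' (by linarith [neg_abs_le (f q.1 q.2)]) ((le_abs_self _).trans hq)
    refine h0.trans ?_
    rw [← sq_abs (g₃ q.1 q.2)]
    nlinarith [sq_nonneg (c * g₁ q.1 q.2 - c * g₂ q.1 q.2),
      sq_nonneg (c * g₁ q.1 q.2 - |g₃ q.1 q.2|), sq_nonneg (c * g₂ q.1 q.2 - |g₃ q.1 q.2|)]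
  have h₁₂ : IntegrableOn (fun q : ℝ × E3 => 3 * c ^ 2 * (g₁ q.1 q.2) ^ 2 +
      3 * c ^ 2 * (g₂ q.1 q.2) ^ 2) Q := (h₁.const_mul _).add (h₂.const_mul _)
  rw [integral_add h₁₂ (h₃.const_mul _),
    integral_add (h₁.const_mul _) (h₂.const_mul _), integral_const_mul, integral_const_mul,
    integral_const_mul] at hle
  have hs (g : ℝ → E3 → ℝ) : ∫ q in Q, (g q.1 q.2) ^ 2 = (L2st g Q) ^ 2 :=
    (Real.sq_sqrt (integral_nonneg fun q => sq_nonneg _)).symm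
  rw [hs, hs, hs, hs] at hle
  have n₁ := mul_nonneg hc (L2st_nonneg g₁ Q)
  have n₂ := mul_nonneg hc (L2st_nonneg g₂ Q)
  have n₃ := L2st_nonneg g₃ Q
  refine le_of_sq_le_sq ?_ (by linarith)
  nlinarith [mul_nonneg n₁ n₂, mul_nonneg n₁ n₃, mul_nonneg n₂ n₃]

lemma SmoothPos.L2st_Dop_Dop_le {u : ℝ → E3 → ℝ} (hu : SmoothPos u) {Q K : Set (ℝ × E3)}
    (hQ : MeasurableSet Q) (hK : IsCompact K) (hQK : Q ⊆ K) {R : ℝ} (hR : 0 < R)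
    (hRK : ∀ q ∈ K, R ≤ q.1) :
    L2st (Dop (Dop u)) Q ≤ 2 * (4 * R⁻¹ * (L2st (fun t x => √(DuSq (Zop 7 u) t x)) Q +
      L2st (fun t x => √(DuSq u t x)) Q) + L2st (wave2 u) Q) := by
  have hpos : ∀ q ∈ K, 0 < q.1 := fun q hq => hR.trans_le (hRK q hq)
  have hsq (v : ℝ → E3 → ℝ) (t : ℝ) (x : E3) : √(DuSq v t x) ^ 2 = DuSq v t x :=
    Real.sq_sqrt (by unfold DuSq; positivity)
  refine L2st_le_of_ae_abs_le (by positivity) ?_ ?_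
    ((hu.integrableOn_wave2_sq hK hpos).mono_set hQK) ?_
  · simpa only [hsq] using ((hu.zop 7).integrableOn_DuSq hK hpos).mono_set hQK
  · simpa only [hsq] using (hu.integrableOn_DuSq hK hpos).mono_set hQK
  · refine (ae_restrict_iff' hQ).2 ?_
    filter_upwards [ae_space_ne_zero] with q hx hq
    exact hu.abs_Dop_Dop_le hR (hRK q (hQK hq)) hx

lemma measurableSet_CRtilde (τ R : ℝ) : MeasurableSet (CRtilde τ R) := by
  have hn : Measurable fun q : ℝ × E3 => ‖q.2‖ := measurable_snd.norm
  refine MeasurableSet.inter ?_ ?_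
  · exact (measurableSet_le measurable_const measurable_fst).inter
      ((measurableSet_le measurable_fst measurable_const).inter
        (measurableSet_le hn (measurable_fst.add_const 2)))
  · split_ifs
    · exact measurableSet_le hn measurable_const
    · exact (measurableSet_le measurable_const hn).inter (measurableSet_le hn measurable_const)

lemma CRtilde_subset (τ R : ℝ) :
    CRtilde τ R ⊆ Icc (7/8*τ) (17/8*τ) ×ˢ Metric.closedBall 0 (17/8*τ + 2) := by
  rintro q ⟨⟨h1, h2, h3⟩, -⟩
  exact ⟨⟨h1, h2⟩, by rw [mem_closedBall_zero_iff]; linarith⟩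

lemma L2st_le_ZnormT (T : (ℝ → E3 → ℝ) → (ℝ → E3 → ℝ)) {N n : ℕ} (hn : n ≤ N)
    (w : ℝ → E3 → ℝ) (Q : Set (ℝ × E3)) (σ : Fin n → Fin 8) :
    L2st (T (Ziter (List.ofFn σ) w)) Q ≤ ZnormT T N w Q := by
  unfold ZnormT
  refine le_trans ?_ (Finset.single_le_sum
    (f := fun n => ∑ σ : Fin n → Fin 8, L2st (T (Ziter (List.ofFn σ) w)) Q)
    (fun i _ => Finset.sum_nonneg fun _ _ => L2st_nonneg _ _)
    (Finset.mem_range.2 (Nat.lt_succ_of_le hn)))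
  exact Finset.single_le_sum (f := fun σ : Fin n → Fin 8 => L2st (T (Ziter (List.ofFn σ) w)) Q)
    (fun _ _ => L2st_nonneg _ _) (Finset.mem_univ σ)

/-- For dyadic `τ = 2^j ≥ 1` and dyadic `1 ≤ R = 2^k ≤ τ/2`,
`‖(∂_t + ∂_r)² Z^{≤2} w‖_{L²L²(C̃^R_τ)} ≲ R⁻¹‖∂Z^{≤3}w‖_{L²L²(C̃^R_τ)}
  + ‖(∂_t²−∂_r²)Z^{≤2}w‖_{L²L²(C̃^R_τ)}`. -/
theorem good_derivative_squared_bound :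
    ∃ C : ℝ, 0 < C ∧ ∀ w : ℝ → E3 → ℝ,
      ContDiffOn ℝ (⊤ : ℕ∞) (fun q : ℝ × E3 => w q.1 q.2) (Ici 0 ×ˢ univ) →
      ∀ j k : ℕ, k + 1 ≤ j →
      ZnormDD w (CRtilde ((2:ℝ)^j) ((2:ℝ)^k)) ≤
        C * ((((2:ℝ)^k))⁻¹ * ZnormD 3 w (CRtilde ((2:ℝ)^j) ((2:ℝ)^k)) +
             ZnormW w (CRtilde ((2:ℝ)^j) ((2:ℝ)^k))) := by
  refine ⟨2000, by norm_num, fun w hw j k hjk => ?_⟩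
  have hu : SmoothPos w := hw.mono (prod_mono Ioi_subset_Ici_self Subset.rfl)
  set R : ℝ := 2 ^ k with hR
  set Q := CRtilde (2 ^ j) R with hQ
  have hR0 : 0 < R := by positivity
  have hτ : 2 * R ≤ 2 ^ j := by
    rw [hR, ← pow_succ']
    exact pow_le_pow_right₀ one_le_two hjk
  set D := ZnormD 3 w Q with hD
  have hterm (n : ℕ) (hn : n ∈ Finset.range 3) (σ : Fin n → Fin 8) :
      L2st (Dop (Dop (Ziter (List.ofFn σ) w))) Q ≤
        16 * (R⁻¹ * D) + 2 * L2st (wave2 (Ziter (List.ofFn σ) w)) Q := by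
    have hn3 : n < 3 := Finset.mem_range.1 hn
    have h := (hu.ziter (List.ofFn σ)).L2st_Dop_Dop_le (measurableSet_CRtilde (2 ^ j) R)
      (isCompact_Icc.prod (isCompact_closedBall _ _)) (CRtilde_subset _ _) hR0
      (fun q hq => by have := hq.1.1; linarith)
    have h1 := L2st_le_ZnormT (fun v t x => √(DuSq v t x)) (N := 3) (by omega) w Q σ
    have h2 := L2st_le_ZnormT (fun v t x => √(DuSq v t x)) (N := 3) (n := n + 1) (by omega) w Q
      (Fin.cons 7 σ)
    rw [List.ofFn_cons] at h2
    have h3 := mul_le_mul_of_nonneg_left (add_le_add h2 h1) (inv_nonneg.2 hR0.le)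
    change R⁻¹ * (L2st (fun t x => √(DuSq (Zop 7 (Ziter (List.ofFn σ) w)) t x)) Q +
      L2st (fun t x => √(DuSq (Ziter (List.ofFn σ) w) t x)) Q) ≤ R⁻¹ * (D + D) at h3
    linarith
  have hsum : ZnormDD w Q ≤ ∑ n ∈ Finset.range 3, ∑ σ : Fin n → Fin 8,
      (16 * (R⁻¹ * D) + 2 * L2st (wave2 (Ziter (List.ofFn σ) w)) Q) :=
    Finset.sum_le_sum (s := Finset.range 3)
      (f := fun n => ∑ σ : Fin n → Fin 8, L2st (Dop (Dop (Ziter (List.ofFn σ) w))) Q)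
      fun n hn => Finset.sum_le_sum fun σ _ => hterm n hn σ
  have heq : ∑ n ∈ Finset.range 3, ∑ σ : Fin n → Fin 8,
      (16 * (R⁻¹ * D) + 2 * L2st (wave2 (Ziter (List.ofFn σ) w)) Q) =
      73 * (16 * (R⁻¹ * D)) + 2 * ZnormW w Q := by
    simp only [Finset.sum_add_distrib, ← Finset.mul_sum, Finset.sum_const, Finset.card_univ,
      Fintype.card_fun, Fintype.card_fin]
    simp only [Finset.sum_range_succ, Finset.sum_range_zero, ZnormW, ZnormT, nsmul_eq_mul]
    push_cast
    ring
  have hnn (T : (ℝ → E3 → ℝ) → (ℝ → E3 → ℝ)) (N : ℕ) : 0 ≤ ZnormT T N w Q :=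
    Finset.sum_nonneg fun _ _ => Finset.sum_nonneg fun _ _ => L2st_nonneg _ _
  have hDn : 0 ≤ R⁻¹ * D := mul_nonneg (inv_nonneg.2 hR0.le) (hnn _ 3)
  have hWn : 0 ≤ ZnormW w Q := hnn _ 2
  rw [heq] at hsum
  linarith
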